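/- arXiv:2310.19270 — 9 statements merged into one kernel-verified Lean document; each statement's English description precedes it below -/
import Mathlib

section
/- For every real λ > 0 and every real t ≠ 0, ∫_0^∞ e^{−λ·r²} · sinh(r) · sin(t·r) dr = (1/2) · √(π/λ) · e^{(1 − t²)/(4λ)} · sin( t/(2λ) ). -/
open MeasureTheory

lemma cexp_ofReal_add_ofReal_mul_I_im (x y : ℝ) :
    (Complex.exp ((x : ℂ) + (y : ℂ) * Complex.I)).im = Real.exp x * Real.sin y := by
  simp [Complex.exp_im]

lemma exp_quadratic_mul_sin_eq_im (b c t r : ℝ) :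
    Real.exp (-b * r ^ 2 + c * r) * Real.sin (t * r)
      = (Complex.exp (-(b : ℂ) * (r : ℂ) ^ 2 + (c + t * Complex.I) * r + 0)).im := by
  have h : -(b : ℂ) * (r : ℂ) ^ 2 + (c + t * Complex.I) * r + 0
      = ((-b * r ^ 2 + c * r : ℝ) : ℂ) + ((t * r : ℝ) : ℂ) * Complex.I := by
    push_cast
    ring
  rw [h, cexp_ofReal_add_ofReal_mul_I_im]

lemma integrable_exp_quadratic_mul_sin {b : ℝ} (hb : 0 < b) (c t : ℝ) :
    Integrable fun r : ℝ => Real.exp (-b * r ^ 2 + c * r) * Real.sin (t * r) := by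
  simp_rw [exp_quadratic_mul_sin_eq_im]
  exact (integrable_cexp_quadratic (b := (b : ℂ)) (by simpa using hb) _ 0).im

lemma integral_exp_quadratic_mul_sin {b : ℝ} (hb : 0 < b) (c t : ℝ) :
    ∫ r : ℝ, Real.exp (-b * r ^ 2 + c * r) * Real.sin (t * r)
      = Real.sqrt (Real.pi / b) * Real.exp ((c ^ 2 - t ^ 2) / (4 * b))
        * Real.sin (c * t / (2 * b)) := by
  have hb₀ : (b : ℂ) ≠ 0 := by exact_mod_cast hb.ne'
  have hint := integrable_cexp_quadratic (b := (b : ℂ)) (by simpa using hb)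
    (c + t * Complex.I) 0
  have him := integral_im hint
  simp_rw [exp_quadratic_mul_sin_eq_im]
  refine him.trans ?_
  rw [integral_cexp_quadratic (by simpa using hb), neg_neg]
  have hsqrt : ((Real.pi : ℂ) / b) ^ (1 / 2 : ℂ) = (Real.sqrt (Real.pi / b) : ℂ) := by
    rw [Real.sqrt_eq_rpow, Complex.ofReal_cpow (by positivity)]
    push_cast
    rfl
  have hexp : (0 : ℂ) - (c + t * Complex.I) ^ 2 / (4 * -b)
      = (((c ^ 2 - t ^ 2) / (4 * b) : ℝ) : ℂ) + ((c * t / (2 * b) : ℝ) : ℂ) * Complex.I := by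
    push_cast
    field_simp
    ring_nf
    rw [Complex.I_sq]
    ring
  rw [hsqrt, hexp, RCLike.im_to_complex, Complex.im_ofReal_mul,
    cexp_ofReal_add_ofReal_mul_I_im, mul_assoc]

/-- Closed form of the spherical transform (up to the factor `4π/t`) of the Gaussian kernel
`g(r) = e^{−λ r²}` on three-dimensional hyperbolic space:
`∫_0^∞ e^{−λ r²} sinh(r) sin(t r) dr = (1/2) √(π/λ) e^{(1−t²)/(4λ)} sin(t/(2λ))`. -/
theorem gaussian_spherical_transform_H3 (lam : ℝ) (hlam : 0 < lam) (t : ℝ) (ht : t ≠ 0) :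
    ∫ r in Set.Ioi (0 : ℝ), Real.exp (-lam * r ^ 2) * Real.sinh r * Real.sin (t * r)
      = (1 / 2) * Real.sqrt (Real.pi / lam) * Real.exp ((1 - t ^ 2) / (4 * lam))
        * Real.sin (t / (2 * lam)) := by
  have heven := integral_comp_abs
    (f := fun r : ℝ => Real.exp (-lam * r ^ 2) * Real.sinh r * Real.sin (t * r))
  have hsplit (r : ℝ) :
      Real.exp (-lam * |r| ^ 2) * Real.sinh |r| * Real.sin (t * |r|)
        = 1 / 2 * (Real.exp (-lam * r ^ 2 + 1 * r) * Real.sin (t * r)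
          - Real.exp (-lam * r ^ 2 + -1 * r) * Real.sin (t * r)) := by
    have habs : Real.exp (-lam * |r| ^ 2) * Real.sinh |r| * Real.sin (t * |r|)
        = Real.exp (-lam * r ^ 2) * Real.sinh r * Real.sin (t * r) := by
      rcases abs_choice r with h | h <;> simp [h]
    rw [habs, Real.sinh_eq, Real.exp_add, Real.exp_add, one_mul, neg_one_mul]
    ring
  simp_rw [hsplit] at heven
  rw [integral_const_mul, integral_sub (integrable_exp_quadratic_mul_sin hlam 1 t)
    (integrable_exp_quadratic_mul_sin hlam (-1) t), integral_exp_quadratic_mul_sin hlam,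
    integral_exp_quadratic_mul_sin hlam, neg_one_mul, neg_div, Real.sin_neg, one_mul,
    neg_one_sq, one_pow] at heven
  linarith
end

section
/- For t, r ∈ ℝ with r ≥ 0, define φ(t, r) = (1/2π) · ∫_0^{2π} (cosh r + sinh r · cos θ)^{−1/2} · cos( t · log(cosh r + sinh r · cos θ) ) dθ (this is the Legendre function P_{−1/2 + i t}(cosh r), i.e. the spherical function of the hyperbolic plane, given by its Laplace integral representation; note cosh r + sinh r cos θ ≥ e^{−r} > 0). Then for every T > 0 there exists λ_T > 0 such that for all λ > λ_T and all t ∈ [0, T], ∫_0^∞ e^{−λ·r²} · φ(t, r) · sinh(r) dr ≥ 0. -/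
open MeasureTheory

lemma exp_neg_le_cosh_add_sinh_mul_cos {r : ℝ} (hr : 0 ≤ r) (θ : ℝ) :
    Real.exp (-r) ≤ Real.cosh r + Real.sinh r * Real.cos θ := by
  rw [← Real.cosh_sub_sinh]
  nlinarith [Real.neg_one_le_cos θ, Real.sinh_nonneg_iff.2 hr]

lemma cosh_add_sinh_mul_cos_le_exp {r : ℝ} (hr : 0 ≤ r) (θ : ℝ) :
    Real.cosh r + Real.sinh r * Real.cos θ ≤ Real.exp r := by
  rw [← Real.cosh_add_sinh]
  nlinarith [Real.cos_le_one θ, Real.sinh_nonneg_iff.2 hr]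

lemma cosh_add_sinh_mul_cos_pos {r : ℝ} (hr : 0 ≤ r) (θ : ℝ) :
    0 < Real.cosh r + Real.sinh r * Real.cos θ :=
  (Real.exp_pos _).trans_le (exp_neg_le_cosh_add_sinh_mul_cos hr θ)

lemma abs_log_cosh_add_sinh_mul_cos_le {r : ℝ} (hr : 0 ≤ r) (θ : ℝ) :
    |Real.log (Real.cosh r + Real.sinh r * Real.cos θ)| ≤ r :=
  abs_le.2 ⟨(Real.le_log_iff_exp_le (cosh_add_sinh_mul_cos_pos hr θ)).2
      (exp_neg_le_cosh_add_sinh_mul_cos hr θ),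
    (Real.log_le_iff_le_exp (cosh_add_sinh_mul_cos_pos hr θ)).2
      (cosh_add_sinh_mul_cos_le_exp hr θ)⟩

lemma continuous_laplace_integrand {r : ℝ} (hr : 0 ≤ r) (t : ℝ) :
    Continuous fun θ : ℝ => (Real.cosh r + Real.sinh r * Real.cos θ) ^ (-(1 / 2 : ℝ))
      * Real.cos (t * Real.log (Real.cosh r + Real.sinh r * Real.cos θ)) := by
  have hc : Continuous fun θ : ℝ => Real.cosh r + Real.sinh r * Real.cos θ := by fun_prop
  have h0 : ∀ θ : ℝ, Real.cosh r + Real.sinh r * Real.cos θ ≠ 0 := fun θ =>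
    (cosh_add_sinh_mul_cos_pos hr θ).ne'
  exact (hc.rpow_const fun θ => Or.inl (h0 θ)).mul
    (Real.continuous_cos.comp (continuous_const.mul (hc.log h0)))

lemma abs_laplace_average_le {r : ℝ} (hr : 0 ≤ r) (t : ℝ) :
    |(1 / (2 * Real.pi)) * ∫ θ in (0 : ℝ)..(2 * Real.pi),
        (Real.cosh r + Real.sinh r * Real.cos θ) ^ (-(1 / 2 : ℝ))
          * Real.cos (t * Real.log (Real.cosh r + Real.sinh r * Real.cos θ))|
      ≤ Real.exp (r / 2) := by
  have hpi := Real.pi_pos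
  have h := intervalIntegral.norm_integral_le_of_norm_le_const (a := 0) (b := 2 * Real.pi)
    (f := fun θ : ℝ => (Real.cosh r + Real.sinh r * Real.cos θ) ^ (-(1 / 2 : ℝ))
          * Real.cos (t * Real.log (Real.cosh r + Real.sinh r * Real.cos θ)))
    (C := Real.exp (r / 2)) (fun θ _ => by
      have hw := cosh_add_sinh_mul_cos_pos hr θ
      rw [Real.norm_eq_abs, abs_mul, abs_of_pos (Real.rpow_pos_of_pos hw _)]
      have h1 : (Real.cosh r + Real.sinh r * Real.cos θ) ^ (-(1 / 2 : ℝ)) ≤ Real.exp (r / 2) := by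
        rw [Real.rpow_def_of_pos hw]
        apply Real.exp_le_exp.2
        linarith [(abs_le.1 (abs_log_cosh_add_sinh_mul_cos_le hr θ)).1]
      exact (mul_le_of_le_one_right (Real.rpow_pos_of_pos hw _).le
        (Real.abs_cos_le_one _)).trans h1)
  rw [Real.norm_eq_abs, sub_zero, abs_of_pos (by positivity : 0 < 2 * Real.pi)] at h
  rw [abs_mul, abs_of_pos (by positivity : 0 < 1 / (2 * Real.pi)), one_div,
    inv_mul_le_iff₀ (by positivity)]
  linarith

lemma le_laplace_average {r t : ℝ} (hr : 0 ≤ r) (hr1 : r ≤ 1) (ht : 0 ≤ t) (htr : t * r ≤ 1) :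
    Real.exp (-(1 / 2)) / 2 ≤ (1 / (2 * Real.pi)) * ∫ θ in (0 : ℝ)..(2 * Real.pi),
        (Real.cosh r + Real.sinh r * Real.cos θ) ^ (-(1 / 2 : ℝ))
          * Real.cos (t * Real.log (Real.cosh r + Real.sinh r * Real.cos θ)) := by
  have hpi := Real.pi_pos
  have h := intervalIntegral.integral_mono_on (μ := volume) (a := 0) (b := 2 * Real.pi)
    (f := fun _ : ℝ => Real.exp (-(1 / 2)) / 2) (by positivity)
    (continuous_const.intervalIntegrable _ _)
    ((continuous_laplace_integrand hr t).intervalIntegrable _ _) (fun θ _ => by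
      have hw := cosh_add_sinh_mul_cos_pos hr θ
      have hl := abs_log_cosh_add_sinh_mul_cos_le hr θ
      have h1 : Real.exp (-(1 / 2)) ≤
          (Real.cosh r + Real.sinh r * Real.cos θ) ^ (-(1 / 2 : ℝ)) := by
        rw [Real.rpow_def_of_pos hw]
        apply Real.exp_le_exp.2
        linarith [(abs_le.1 hl).2]
      have h2 : |t * Real.log (Real.cosh r + Real.sinh r * Real.cos θ)| ≤ 1 := by
        rw [abs_mul, abs_of_nonneg ht]
        exact (mul_le_mul_of_nonneg_left hl ht).trans htr
      have h3 : 1 / 2 ≤ Real.cos (t * Real.log (Real.cosh r + Real.sinh r * Real.cos θ)) := by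
        have := Real.one_sub_sq_div_two_le_cos
          (x := t * Real.log (Real.cosh r + Real.sinh r * Real.cos θ))
        have := (sq_le_one_iff_abs_le_one _).2 h2
        linarith
      rw [div_eq_mul_one_div]
      exact mul_le_mul h1 h3 (by norm_num) (Real.rpow_pos_of_pos hw _).le)
  rw [intervalIntegral.integral_const, sub_zero, smul_eq_mul] at h
  rw [one_div (2 * Real.pi), le_inv_mul_iff₀ (by positivity)]
  exact h

/-- A function that is bounded below by `c > 0` near the origin and grows at most like
`exp (r / 2)` has nonnegative integral against `exp (-lam * r ^ 2) * sinh r` on the half-line,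
once `lam` is large in terms of `a` and `c` only. -/
lemma exists_forall_integral_gaussian_mul_sinh_nonneg {a c : ℝ} (ha : 0 < a) (hc : 0 < c) :
    ∃ L : ℝ, 0 < L ∧ ∀ lam : ℝ, L < lam → ∀ f : ℝ → ℝ,
      (∀ r, 0 < r → r ≤ a → c ≤ f r) → (∀ r, 0 < r → |f r| ≤ Real.exp (r / 2)) →
        0 ≤ ∫ r in Set.Ioi (0 : ℝ), Real.exp (-lam * r ^ 2) * f r * Real.sinh r := by
  set J : ℝ := ∫ r in Set.Ioi (0 : ℝ), Real.exp (-(1 / 2) * r ^ 2) with hJ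
  have hG : IntegrableOn (fun r : ℝ => Real.exp (-(1 / 2) * r ^ 2)) (Set.Ioi 0) :=
    (integrable_exp_neg_mul_sq (by norm_num)).integrableOn
  obtain ⟨L, hL⟩ : ∃ L : ℝ, ∀ lam, L ≤ lam →
      Real.exp (-(3 / 4 * a ^ 2 * lam)) * (Real.exp (a ^ 2 + 9 / 8) * J) ≤ c * (a / 4) * (a / 4) := by
    have h : Filter.Tendsto (fun lam : ℝ =>
        Real.exp (-(3 / 4 * a ^ 2 * lam)) * (Real.exp (a ^ 2 + 9 / 8) * J))
        Filter.atTop (nhds (0 * (Real.exp (a ^ 2 + 9 / 8) * J))) :=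
      (Real.tendsto_exp_neg_atTop_nhds_zero.comp
        (Filter.tendsto_id.const_mul_atTop (by positivity))).mul_const _
    rw [zero_mul] at h
    exact Filter.eventually_atTop.1 (h.eventually_le_const (by positivity))
  refine ⟨max L 1, by positivity, fun lam hlam f hf hf' => ?_⟩
  have hlam1 : 1 < lam := (le_max_right _ _).trans_lt hlam
  by_cases hint : IntegrableOn
    (fun r : ℝ => Real.exp (-lam * r ^ 2) * f r * Real.sinh r) (Set.Ioi 0)
  swap
  · exact (integral_undef hint).ge
  set A : ℝ := Real.exp (-lam * (a / 2) ^ 2) * c * (a / 4) with hA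
  set B : ℝ := Real.exp (-(lam - 1) * a ^ 2 + 9 / 8) with hB
  have hA0 : 0 < A := by positivity
  have hB0 : 0 < B := by positivity
  have hsub : Set.Ioc (a / 4) (a / 2) ⊆ Set.Ioi 0 := fun r hr => lt_trans (by positivity) hr.1
  have hi1 : IntegrableOn ((Set.Ioc (a / 4) (a / 2)).indicator fun _ : ℝ => A) (Set.Ioi 0) := by
    refine Integrable.integrableOn ?_
    rw [integrable_indicator_iff measurableSet_Ioc]
    exact integrableOn_const (by simp)
  have hi2 := hG.const_mul B
  have hpt : ∀ r ∈ Set.Ioi (0 : ℝ),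
      (Set.Ioc (a / 4) (a / 2)).indicator (fun _ : ℝ => A) r - B * Real.exp (-(1 / 2) * r ^ 2)
        ≤ Real.exp (-lam * r ^ 2) * f r * Real.sinh r := by
    intro r hr
    have hr0 : 0 < r := hr
    have hs : r ≤ Real.sinh r := Real.self_le_sinh_iff.2 hr0.le
    have hBr : 0 < B * Real.exp (-(1 / 2) * r ^ 2) := by positivity
    rcases le_or_gt r a with hra | hra
    · have hfr := hf r hr0 hra
      have hfr0 := hc.trans_le hfr
      have hsr0 := hr0.trans_le hs
      by_cases hm : r ∈ Set.Ioc (a / 4) (a / 2)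
      · rw [Set.indicator_of_mem hm]
        have he : Real.exp (-lam * (a / 2) ^ 2) ≤ Real.exp (-lam * r ^ 2) := by
          apply Real.exp_le_exp.2
          have : r ^ 2 ≤ (a / 2) ^ 2 := pow_le_pow_left₀ hr0.le hm.2 2
          nlinarith
        have : A ≤ Real.exp (-lam * r ^ 2) * f r * Real.sinh r := by
          rw [hA]
          have := hm.1.le.trans hs
          gcongr
        linarith
      · rw [Set.indicator_of_notMem hm]
        have : 0 < Real.exp (-lam * r ^ 2) * f r * Real.sinh r := by positivity
        linarith
    · rw [Set.indicator_of_notMem (fun hm => by linarith [hm.2]), zero_sub]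
      refine (abs_le.1 ?_).1
      have hsr0 := hr0.trans_le hs
      have hse : Real.sinh r ≤ Real.exp r := by
        rw [← Real.cosh_add_sinh]
        linarith [Real.cosh_pos r]
      rw [abs_mul, abs_mul, abs_of_pos hsr0, abs_of_pos (Real.exp_pos _)]
      calc Real.exp (-lam * r ^ 2) * |f r| * Real.sinh r
          ≤ Real.exp (-lam * r ^ 2) * Real.exp (r / 2) * Real.exp r := by
            have := hf' r hr0
            gcongr
        _ = Real.exp (-lam * r ^ 2 + r / 2 + r) := by rw [Real.exp_add, Real.exp_add]
        _ ≤ Real.exp ((-(lam - 1) * a ^ 2 + 9 / 8) + -(1 / 2) * r ^ 2) := by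
            apply Real.exp_le_exp.2
            have : a ^ 2 ≤ r ^ 2 := pow_le_pow_left₀ ha.le hra.le 2
            nlinarith [sq_nonneg (r - 3 / 2), mul_nonneg (sub_nonneg.2 hlam1.le) (sub_nonneg.2 this)]
        _ = _ := Real.exp_add _ _
  have hmono := setIntegral_mono_on (hi1.sub hi2) hint measurableSet_Ioi hpt
  refine le_trans ?_ hmono
  have hI : ∫ r in Set.Ioi (0 : ℝ), (Set.Ioc (a / 4) (a / 2)).indicator (fun _ : ℝ => A) r
      = (a / 4) * A := by
    rw [setIntegral_indicator measurableSet_Ioc, Set.inter_eq_right.2 hsub, setIntegral_const,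
      Real.volume_real_Ioc_of_le (by linarith), smul_eq_mul]
    ring
  have hsplit := integral_sub hi1 hi2
  simp only [Pi.sub_apply] at hsplit ⊢
  rw [hsplit, hI, integral_const_mul, ← hJ, sub_nonneg]
  calc B * J = Real.exp (-lam * (a / 2) ^ 2) *
        (Real.exp (-(3 / 4 * a ^ 2 * lam)) * (Real.exp (a ^ 2 + 9 / 8) * J)) := by
        rw [hB, ← mul_assoc, ← mul_assoc, ← Real.exp_add, ← Real.exp_add]
        ring_nf
    _ ≤ Real.exp (-lam * (a / 2) ^ 2) * (c * (a / 4) * (a / 4)) := by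
        have := hL lam ((le_max_left _ _).trans hlam.le)
        gcongr
    _ = a / 4 * A := by rw [hA]; ring

/-- Positivity of the spherical (Mehler–Fock) transform of the Gaussian kernel on the
hyperbolic plane for small `t` relative to `λ`: with `φ(t,r)` the Legendre function
`P_{−1/2+it}(cosh r)` given by its Laplace integral representation, for every `T > 0` there is
`λ_T > 0` such that `λ > λ_T` implies `∫_0^∞ e^{−λ r²} φ(t,r) sinh(r) dr ≥ 0` for all
`t ∈ [0, T]`. -/
theorem gaussian_spherical_transform_H2_small_t (φ : ℝ → ℝ → ℝ)
    (hφ : ∀ t r : ℝ, φ t r =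
      (1 / (2 * Real.pi)) * ∫ θ in (0 : ℝ)..(2 * Real.pi),
        (Real.cosh r + Real.sinh r * Real.cos θ) ^ (-(1 / 2 : ℝ))
          * Real.cos (t * Real.log (Real.cosh r + Real.sinh r * Real.cos θ))) :
    ∀ T : ℝ, 0 < T → ∃ lamT : ℝ, 0 < lamT ∧ ∀ lam : ℝ, lamT < lam →
      ∀ t ∈ Set.Icc (0 : ℝ) T,
        0 ≤ ∫ r in Set.Ioi (0 : ℝ), Real.exp (-lam * r ^ 2) * φ t r * Real.sinh r := by
  intro T hT
  obtain ⟨L, hL0, hL⟩ := exists_forall_integral_gaussian_mul_sinh_nonneg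
    (a := min 1 T⁻¹) (c := Real.exp (-(1 / 2)) / 2) (by positivity) (by positivity)
  refine ⟨L, hL0, fun lam hlam t ht => hL lam hlam (φ t) (fun r hr hra => ?_) fun r hr => ?_⟩
  · rw [hφ]
    refine le_laplace_average hr.le (hra.trans (min_le_left _ _)) ht.1 ?_
    calc t * r ≤ T * T⁻¹ :=
          mul_le_mul ht.2 (hra.trans (min_le_right _ _)) hr.le hT.le
      _ = 1 := mul_inv_cancel₀ hT.ne'
  · rw [hφ]
    exact abs_laplace_average_le hr.le t
end

section
/- For every real a > 1/2, the hyperbolic secant kernel k(z, w) = (cosh d(z, w))^{−a} is positive-definite on the hyperbolic plane. -/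
/-- The exponential kernel `exp (s x y)` with `s ≥ 0` is positive-definite on `ℝ`. -/
theorem sum_exp_mul_mul_nonneg {ι : Type*} [Fintype ι] {s : ℝ} (hs : 0 ≤ s) (x b : ι → ℝ) :
    0 ≤ ∑ i, ∑ j, Real.exp (s * (x i * x j)) * b i * b j := by
  have h : HasSum (fun n : ℕ => ∑ i, ∑ j, (s * (x i * x j)) ^ n / n.factorial * b i * b j)
      (∑ i, ∑ j, Real.exp (s * (x i * x j)) * b i * b j) := by
    refine hasSum_sum fun i _ => hasSum_sum fun j _ => ?_
    refine HasSum.mul_right _ (HasSum.mul_right _ ?_)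
    rw [Real.exp_eq_exp_ℝ]
    exact NormedSpace.expSeries_div_hasSum_exp _
  refine h.nonneg fun n => ?_
  have : ∑ i, ∑ j, (s * (x i * x j)) ^ n / n.factorial * b i * b j
      = s ^ n / n.factorial * ((∑ i, x i ^ n * b i) * ∑ j, x j ^ n * b j) := by
    rw [Finset.sum_mul_sum, Finset.mul_sum]
    refine Finset.sum_congr rfl fun i _ => ?_
    rw [Finset.mul_sum]
    refine Finset.sum_congr rfl fun j _ => ?_
    ring
  rw [this]
  exact mul_nonneg (by positivity) (mul_self_nonneg _)

open MeasureTheory in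
/-- If `p i + p j - 2 x i x j` is always positive, its negative powers form a
positive-definite kernel. -/
theorem sum_rpow_neg_mul_nonneg {ι : Type*} [Fintype ι] {a : ℝ} (ha : 0 < a) (p x b : ι → ℝ)
    (hD : ∀ i j, 0 < p i + p j - 2 * (x i * x j)) :
    0 ≤ ∑ i, ∑ j, (p i + p j - 2 * (x i * x j)) ^ (-a) * b i * b j := by
  have hΓ : 0 < Real.Gamma a := Real.Gamma_pos_of_pos ha
  have key : ∀ i j, ∫ t in Set.Ioi (0 : ℝ),
      t ^ (a - 1) * Real.exp (-((p i + p j - 2 * (x i * x j)) * t))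
        = (p i + p j - 2 * (x i * x j)) ^ (-a) * Real.Gamma a := fun i j => by
    rw [Real.integral_rpow_mul_exp_neg_mul_Ioi ha (hD i j), one_div,
      Real.inv_rpow (hD i j).le, Real.rpow_neg (hD i j).le]
  have hint : ∀ i j, IntegrableOn
      (fun t => t ^ (a - 1) * Real.exp (-((p i + p j - 2 * (x i * x j)) * t)))
      (Set.Ioi (0 : ℝ)) := fun i j => by
    refine not_imp_comm.1 integral_undef ?_
    rw [key]
    exact (mul_pos (Real.rpow_pos_of_pos (hD i j) _) hΓ).ne'
  refine nonneg_of_mul_nonneg_left ?_ hΓ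
  have h : (∑ i, ∑ j, (p i + p j - 2 * (x i * x j)) ^ (-a) * b i * b j) * Real.Gamma a
      = ∫ t in Set.Ioi (0 : ℝ), ∑ i, ∑ j,
        t ^ (a - 1) * Real.exp (-((p i + p j - 2 * (x i * x j)) * t)) * (b i * b j) := by
    rw [integral_finsetSum _ fun i _ => integrable_finsetSum _ fun j _ =>
      (hint i j).mul_const _, Finset.sum_mul]
    refine Finset.sum_congr rfl fun i _ => ?_
    rw [integral_finsetSum _ fun j _ => (hint i j).mul_const _, Finset.sum_mul]
    refine Finset.sum_congr rfl fun j _ => ?_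
    rw [integral_mul_const, key]
    ring
  rw [h]
  refine setIntegral_nonneg measurableSet_Ioi fun t (ht : 0 < t) => ?_
  have e := mul_nonneg (Real.rpow_nonneg ht.le (a - 1)) (sum_exp_mul_mul_nonneg
    (show 0 ≤ 2 * t by positivity) x fun i => Real.exp (-(p i * t)) * b i)
  refine e.trans_eq ?_
  simp only [Finset.mul_sum]
  refine Finset.sum_congr rfl fun i _ => Finset.sum_congr rfl fun j _ => ?_
  rw [show -((p i + p j - 2 * (x i * x j)) * t)
    = 2 * t * (x i * x j) + -(p i * t) + -(p j * t) by ring, Real.exp_add, Real.exp_add]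
  ring

/-- A symmetric real kernel that is nonnegative on real coefficients is nonnegative on complex
coefficients. -/
theorem sum_ofReal_mul_conj_nonneg {ι : Type*} [Fintype ι] {k : ι → ι → ℝ}
    (hk : ∀ i j, k i j = k j i) (h : ∀ b : ι → ℝ, 0 ≤ ∑ i, ∑ j, k i j * b i * b j)
    (c : ι → ℂ) :
    0 ≤ (∑ i, ∑ j, (k i j : ℂ) * c i * (starRingEnd ℂ) (c j)).re ∧
      0 = (∑ i, ∑ j, (k i j : ℂ) * c i * (starRingEnd ℂ) (c j)).im := by
  constructor
  · refine (add_nonneg (h fun i => (c i).re) (h fun i => (c i).im)).trans_eq ?_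
    simp only [Complex.re_sum, ← Finset.sum_add_distrib]
    refine Finset.sum_congr rfl fun i _ => Finset.sum_congr rfl fun j _ => ?_
    simp
  · have e : (∑ i, ∑ j, (k i j : ℂ) * c i * (starRingEnd ℂ) (c j)).im
        = (∑ i, ∑ j, k i j * (c i).im * (c j).re) - ∑ i, ∑ j, k i j * (c i).re * (c j).im := by
      simp only [Complex.im_sum, ← Finset.sum_sub_distrib]
      refine Finset.sum_congr rfl fun i _ => Finset.sum_congr rfl fun j _ => ?_
      simp
      ring
    rw [e, eq_comm, sub_eq_zero, Finset.sum_comm]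
    refine Finset.sum_congr rfl fun i _ => Finset.sum_congr rfl fun j _ => ?_
    rw [hk]
    ring

open scoped ComplexOrder in
/-- For every `a > 1/2`, the hyperbolic secant kernel `k(z,w) = (cosh d(z,w))^{−a}` is
positive-definite on the hyperbolic plane (the upper half-plane with its Poincaré metric,
which satisfies `cosh (d z w) = 1 + |z − w|²/(2 Im z Im w)`). -/
theorem hyperbolic_secant_kernel_posdef (a : ℝ) (ha : 1 / 2 < a) :
    ∀ (N : ℕ) (x : Fin N → UpperHalfPlane) (c : Fin N → ℂ),
      0 ≤ ∑ i, ∑ j, ((Real.cosh (dist (x i) (x j)) ^ (-a) : ℝ) : ℂ)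
        * c i * (starRingEnd ℂ) (c j) := by
  intro N x c
  rw [Complex.le_def]
  refine sum_ofReal_mul_conj_nonneg (fun i j => by rw [dist_comm]) (fun b => ?_) c
  have hD : ∀ i j, 0 < ((x i).re ^ 2 + (x i).im ^ 2) + ((x j).re ^ 2 + (x j).im ^ 2)
      - 2 * ((x i).re * (x j).re) := fun i j => by
    nlinarith [sq_nonneg ((x i).re - (x j).re), pow_pos (x i).im_pos 2, pow_pos (x j).im_pos 2]
  have h := mul_nonneg (Real.rpow_nonneg zero_le_two a)
    (sum_rpow_neg_mul_nonneg (by linarith : 0 < a) (fun i => (x i).re ^ 2 + (x i).im ^ 2)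
      (fun i => (x i).re) (fun i => (x i).im ^ a * b i) hD)
  refine h.trans_eq ?_
  simp only [Finset.mul_sum]
  refine Finset.sum_congr rfl fun i _ => Finset.sum_congr rfl fun j _ => ?_
  have hi := (x i).im_pos
  have hj := (x j).im_pos
  have e : ((x i).re - (x j).re) ^ 2 + (x i).im ^ 2 + (x j).im ^ 2
      = ((x i).re ^ 2 + (x i).im ^ 2) + ((x j).re ^ 2 + (x j).im ^ 2)
        - 2 * ((x i).re * (x j).re) := by ring
  rw [UpperHalfPlane.cosh_dist', e, Real.div_rpow (hD i j).le (by positivity),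
    Real.rpow_neg (by positivity : 0 ≤ 2 * (x i).im * (x j).im), div_inv_eq_mul,
    Real.mul_rpow (by positivity) hj.le, Real.mul_rpow zero_le_two hi.le]
  ring
end

section
/- For every real a > 0, the Wishart kernel k(z, w) = exp(−2a · cosh d(z, w)) is NOT positive-definite on the hyperbolic plane. -/
/-- A real function `f` for which the translation-invariant kernel `f (s - t)` on the line is
positive semidefinite. -/
def IsPosDefFun (f : ℝ → ℝ) : Prop :=
  ∀ (ι : Type) [Fintype ι] (x c : ι → ℝ), 0 ≤ ∑ i, ∑ j, f (x i - x j) * c i * c j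

theorem IsPosDefFun.apply_zero_nonneg {f : ℝ → ℝ} (hf : IsPosDefFun f) : 0 ≤ f 0 := by
  simpa using hf Unit (fun _ => 0) (fun _ => 1)

theorem IsPosDefFun.second_difference {f : ℝ → ℝ} (hf : IsPosDefFun f) (h : ℝ) :
    IsPosDefFun fun u => (2 * f u - f (u + h) - f (u - h)) / h ^ 2 := by
  intro ι _ x c
  have H := hf (ι ⊕ ι) (Sum.elim (fun i => x i + h) x) (Sum.elim c fun i => -c i)
  simp only [Fintype.sum_sum_type, Sum.elim_inl, Sum.elim_inr, ← Finset.sum_add_distrib] at H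
  have key : ∑ i, ∑ j, (2 * f (x i - x j) - f (x i - x j + h) - f (x i - x j - h)) / h ^ 2
      * c i * c j = (∑ i, ∑ j, (2 * f (x i - x j) - f (x i - x j + h) - f (x i - x j - h))
      * c i * c j) / h ^ 2 := by
    simp only [Finset.sum_div]
    refine Finset.sum_congr rfl fun i _ => Finset.sum_congr rfl fun j _ => ?_
    ring
  rw [key]
  refine div_nonneg (H.trans_eq ?_) (sq_nonneg h)
  refine Finset.sum_congr rfl fun i _ => Finset.sum_congr rfl fun j _ => ?_
  rw [show x i + h - (x j + h) = x i - x j by ring, show x i + h - x j = x i - x j + h by ring,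
    show x i - (x j + h) = x i - x j - h by ring]
  ring

open Filter Topology in
theorem tendsto_second_difference {f f' f'' : ℝ → ℝ} (hf : ∀ x, HasDerivAt f (f' x) x)
    (hf' : ∀ x, HasDerivAt f' (f'' x) x) (u : ℝ) :
    Tendsto (fun h => (2 * f u - f (u + h) - f (u - h)) / h ^ 2) (𝓝[>] 0) (𝓝 (-f'' u)) := by
  have hnum : ∀ h, HasDerivAt (fun h => 2 * f u - f (u + h) - f (u - h))
      (f' (u - h) - f' (u + h)) h := by
    intro h
    have h1 := (hf (u + h)).comp_const_add u h
    have h2 := (hf (u - h)).comp_const_sub u h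
    exact ((h1.const_sub (2 * f u)).sub h2).congr_deriv (by ring)
  have hden : ∀ h : ℝ, HasDerivAt (fun h : ℝ => h ^ 2) (2 * h) h := by
    intro h
    simpa using hasDerivAt_pow 2 h
  have hdiff : HasDerivAt (fun h => f' (u - h) - f' (u + h)) (-f'' u - f'' u) 0 := by
    have h1 : HasDerivAt f' (f'' u) (u + 0) := by simpa using hf' u
    have h2 : HasDerivAt f' (f'' u) (u - 0) := by simpa using hf' u
    exact (h2.comp_const_sub u 0).sub (h1.comp_const_add u 0)
  have hslope := (hdiff.tendsto_slope_zero_right).const_mul (1 / 2)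
  refine HasDerivAt.lhopital_zero_nhdsGT (.of_forall hnum) (.of_forall hden) ?_ ?_ ?_ ?_
  · filter_upwards [self_mem_nhdsWithin] with h hh
    exact (mul_pos two_pos hh).ne'
  · have := (hnum 0).continuousAt.tendsto.mono_left (nhdsWithin_le_nhds (s := Set.Ioi 0))
    convert this using 2
    simp
    ring
  · have := (hden 0).continuousAt.tendsto.mono_left (nhdsWithin_le_nhds (s := Set.Ioi 0))
    simpa using this
  · convert hslope using 1
    · ext h
      simp only [zero_add, sub_zero, add_zero, sub_self, smul_eq_mul]
      ring
    · congr 1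
      ring

open Filter Topology in
theorem IsPosDefFun.neg_deriv_deriv {f f' f'' : ℝ → ℝ} (hpd : IsPosDefFun f)
    (hf : ∀ x, HasDerivAt f (f' x) x) (hf' : ∀ x, HasDerivAt f' (f'' x) x) :
    IsPosDefFun fun x => -f'' x := by
  intro ι _ x c
  refine ge_of_tendsto' (x := 𝓝[>] (0 : ℝ)) ?_ fun h => hpd.second_difference h ι x c
  exact tendsto_finsetSum _ fun i _ => tendsto_finsetSum _ fun j _ =>
    ((tendsto_second_difference hf hf' _).mul_const _).mul_const _

theorem IsPosDefFun.iteratedDeriv_even {F : ℂ → ℂ} (hF : Differentiable ℂ F)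
    (hpd : IsPosDefFun fun x => (F x).re) (n : ℕ) :
    IsPosDefFun fun x => (-1) ^ n * (iteratedDeriv (2 * n) F x).re := by
  have hd : ∀ k (x : ℝ), HasDerivAt (fun x : ℝ => (iteratedDeriv k F x).re)
      (iteratedDeriv (k + 1) F x).re x := by
    intro k x
    have h : DifferentiableAt ℂ (iteratedDeriv k F) x :=
      (hF.contDiff (n := ⊤)).differentiable_iteratedDeriv k (by exact_mod_cast WithTop.coe_lt_top _) _
    rw [iteratedDeriv_succ]
    exact h.hasDerivAt.real_of_complex
  induction n with
  | zero => simpa using hpd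
  | succ n ih =>
    have := ih.neg_deriv_deriv (fun x => (hd (2 * n) x).const_mul _)
      (fun x => (hd (2 * n + 1) x).const_mul _)
    convert this using 2
    rw [show 2 * (n + 1) = 2 * n + 1 + 1 by ring]
    ring

/-- The restriction of an even entire function to the imaginary axis is monotone on the positive
half-line if its restriction to the real axis is positive definite. -/
theorem IsPosDefFun.re_le_re_of_le {F : ℂ → ℂ} (hF : Differentiable ℂ F)
    (heven : ∀ z, F (-z) = F z) (hpd : IsPosDefFun fun x => (F x).re) {s t : ℝ} (hs : 0 ≤ s)
    (hst : s ≤ t) : (F (s * Complex.I)).re ≤ (F (t * Complex.I)).re := by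
  have hsum : ∀ y : ℝ, HasSum (fun n : ℕ =>
      ((n.factorial : ℂ)⁻¹ * (y * Complex.I) ^ n * iteratedDeriv n F 0).re)
      (F (y * Complex.I)).re := by
    intro y
    have := Complex.hasSum_taylorSeries_of_entire hF 0 (y * Complex.I)
    simp only [sub_zero, smul_eq_mul] at this
    convert Complex.hasSum_re this using 2
    ring_nf
  refine hasSum_le (fun n => ?_) (hsum s) (hsum t)
  obtain ⟨m, rfl | rfl⟩ := n.even_or_odd'
  · have hterm : ∀ y : ℝ, (((2 * m).factorial : ℂ)⁻¹ * (y * Complex.I) ^ (2 * m)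
        * iteratedDeriv (2 * m) F 0).re
        = ((2 * m).factorial : ℝ)⁻¹ * y ^ (2 * m)
          * ((-1) ^ m * (iteratedDeriv (2 * m) F 0).re) := by
      intro y
      have : (((2 * m).factorial : ℂ)⁻¹ * (y * Complex.I) ^ (2 * m))
          = ((((2 * m).factorial : ℝ)⁻¹ * y ^ (2 * m) * (-1) ^ m : ℝ) : ℂ) := by
        rw [mul_pow, pow_mul Complex.I, Complex.I_sq]
        push_cast
        ring
      rw [this, Complex.re_ofReal_mul]
      ring
    rw [hterm, hterm]
    have := (IsPosDefFun.iteratedDeriv_even hF hpd m).apply_zero_nonneg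
    simp only [Complex.ofReal_zero] at this
    gcongr
  · have hzero : iteratedDeriv (2 * m + 1) F 0 = 0 := by
      have := iteratedDeriv_comp_neg (2 * m + 1) F 0
      simp only [heven, neg_zero, Odd.neg_one_pow (odd_two_mul_add_one m), neg_smul, one_smul]
        at this
      exact self_eq_neg.mp this
    simp [hzero]

open scoped ComplexOrder in
/-- For every `a > 0`, the Wishart kernel `k(z,w) = exp(−2a cosh d(z,w))` is not
positive-definite on the hyperbolic plane (the upper half-plane with its Poincaré metric,
which satisfies `cosh (d z w) = 1 + |z − w|²/(2 Im z Im w)`). -/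
theorem wishart_kernel_not_posdef (a : ℝ) (ha : 0 < a) :
    ¬ (∀ (N : ℕ) (x : Fin N → UpperHalfPlane) (c : Fin N → ℂ),
      0 ≤ ∑ i, ∑ j, ((Real.exp (-2 * a * Real.cosh (dist (x i) (x j))) : ℝ) : ℂ)
        * c i * (starRingEnd ℂ) (c j)) := by
  intro H
  have hre : ∀ x : ℝ, (Complex.exp (-2 * a * Complex.cosh x)).re
      = Real.exp (-2 * a * Real.cosh x) := by
    intro x
    rw [← Complex.ofReal_re (Real.exp _)]
    push_cast
    rfl
  have hdist : ∀ s t : ℝ, Real.cosh (dist (⟨⟨0, Real.exp s⟩, Real.exp_pos s⟩ : UpperHalfPlane)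
      ⟨⟨0, Real.exp t⟩, Real.exp_pos t⟩) = Real.cosh (s - t) := by
    intro s t
    rw [UpperHalfPlane.dist_of_re_eq (by simp [UpperHalfPlane.re])]
    simp [UpperHalfPlane.im, Real.dist_eq, Real.cosh_abs]
  have hpd : IsPosDefFun fun x => (Complex.exp (-2 * a * Complex.cosh x)).re := by
    intro ι _ x c
    let e := Fintype.equivFin ι
    have h := H (Fintype.card ι)
      (fun i => ⟨⟨0, Real.exp (x (e.symm i))⟩, Real.exp_pos _⟩) (fun i => (c (e.symm i) : ℂ))
    simp only [hdist, Complex.conj_ofReal] at h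
    have h' : 0 ≤ ∑ i, ∑ j, Real.exp (-2 * a * Real.cosh (x (e.symm i) - x (e.symm j)))
        * c (e.symm i) * c (e.symm j) := by
      rw [← Complex.zero_le_real]
      exact_mod_cast h
    rw [← e.symm.sum_comp]
    simp_rw [hre, ← e.symm.sum_comp (fun j => Real.exp (-2 * a * Real.cosh (x _ - x j)) * _ * c j)]
    exact h'
  have hF : Differentiable ℂ fun z => Complex.exp (-2 * a * Complex.cosh z) := by fun_prop
  have h := IsPosDefFun.re_le_re_of_le hF (fun z => by simp) hpd Real.pi_pos.le
    (show Real.pi ≤ 2 * Real.pi by linarith [Real.pi_pos])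
  have h1 : Complex.exp (-2 * a * Complex.cosh (Real.pi * Complex.I)) = (Real.exp (2 * a) : ℝ) := by
    simp [Complex.cosh_mul_I]
  have h2 : Complex.exp (-2 * a * Complex.cosh ((2 * Real.pi : ℝ) * Complex.I))
      = (Real.exp (-2 * a) : ℝ) := by
    rw [Complex.cosh_mul_I]
    simp
  rw [h1, h2, Complex.ofReal_re, Complex.ofReal_re, Real.exp_le_exp] at h
  linarith
end

section
/- For every integer n ≥ 0 and every real σ, ∫_ℝ (cosh r)^{−(2n+1)} · e^{i σ r} dr = (π / (2n)!) · (1 / cosh(π σ / 2)) · ∏_{m=0}^{n−1} ( σ² + (2m+1)² ). -/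
open MeasureTheory Finset

/-- The Fourier transform of a power of the hyperbolic secant as a beta integral. -/
theorem integral_inv_cosh_pow_mul_cexp (k : ℕ) (σ : ℝ) :
    ∫ r : ℝ, (((Real.cosh r ^ (k + 1))⁻¹ : ℝ) : ℂ) * Complex.exp (Complex.I * σ * r)
      = 2 ^ k * Complex.betaIntegral ((k + 1 + Complex.I * σ) / 2)
          ((k + 1 - Complex.I * σ) / 2) := by
  have hx (r : ℝ) : Real.sigmoid (2 * r) = Real.exp (r - Real.log (2 * Real.cosh r)) := by
    have := Real.cosh_pos r
    rw [Real.exp_sub, Real.exp_log (by positivity), Real.cosh_eq, Real.sigmoid_def]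
    have h : Real.exp (-(2 * r)) = Real.exp (-r) * Real.exp (-r) := by
      rw [← Real.exp_add]; congr 1; ring
    have h' : Real.exp r * Real.exp (-r) = 1 := by rw [← Real.exp_add]; simp
    have := Real.exp_pos (-r)
    have := Real.exp_pos r
    rw [h]
    field_simp
    linear_combination (-Real.exp (-r)) * h'
  have hy (r : ℝ) : 1 - Real.sigmoid (2 * r) = Real.exp (-r - Real.log (2 * Real.cosh r)) := by
    rw [← Real.sigmoid_neg, ← mul_neg, hx, Real.cosh_neg]
  have hf (r : ℝ) : HasDerivAt (fun r : ℝ => Real.sigmoid (2 * r))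
      (2 * (Real.sigmoid (2 * r) * (1 - Real.sigmoid (2 * r)))) r := by
    have := (Real.hasDerivAt_sigmoid (2 * r)).comp r ((hasDerivAt_id r).const_mul 2)
    exact this.congr_deriv (by simp; ring)
  have hinj : Function.Injective (fun r : ℝ => Real.sigmoid (2 * r)) := fun a b h => by
    have := Real.sigmoid_injective h
    linarith
  have hrange : (fun r : ℝ => Real.sigmoid (2 * r)) '' Set.univ = Set.Ioo 0 1 := by
    rw [Set.image_univ, ← Real.range_sigmoid]
    exact (mul_left_surjective₀ (two_ne_zero (α := ℝ))).range_comp Real.sigmoid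
  rw [Complex.betaIntegral, intervalIntegral.integral_of_le zero_le_one,
    integral_Ioc_eq_integral_Ioo, ← hrange,
    integral_image_eq_integral_abs_deriv_smul MeasurableSet.univ
      (fun r _ => (hf r).hasDerivWithinAt) hinj.injOn, setIntegral_univ, ← integral_const_mul]
  congr 1 with r
  have hc := Real.cosh_pos r
  have hL : Complex.exp (Real.log (2 * Real.cosh r)) = 2 * Complex.cosh r := by
    rw [← Complex.ofReal_exp, Real.exp_log (by positivity)]; push_cast; rfl
  have hp (t : ℝ) (w : ℂ) : ((Real.exp t : ℝ) : ℂ) ^ w = Complex.exp (t * w) := by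
    rw [Complex.cpow_def_of_ne_zero (by exact_mod_cast (Real.exp_pos t).ne'),
      ← Complex.ofReal_log (Real.exp_pos t).le, Real.log_exp]
  have h1 : (1 : ℂ) - (Real.sigmoid (2 * r) : ℝ) = ((1 - Real.sigmoid (2 * r) : ℝ) : ℂ) := by
    push_cast; rfl
  rw [h1, hy, hx, hp, hp, abs_of_pos (by positivity)]
  set L := Real.log (2 * Real.cosh r)
  have hpow : (2 * Complex.cosh r) ^ (k + 1) = Complex.exp (((k + 1 : ℕ) : ℂ) * L) := by
    rw [Complex.exp_nat_mul, hL]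
  have hinv : (Complex.cosh r ^ (k + 1))⁻¹
      = 2 ^ (k + 1) * Complex.exp (-(((k + 1 : ℕ) : ℂ) * L)) := by
    rw [Complex.exp_neg, ← hpow, mul_pow, mul_inv, mul_inv_cancel_left₀ (pow_ne_zero _ two_ne_zero)]
  rw [Complex.real_smul]
  push_cast
  rw [hinv, pow_succ, mul_assoc _ (Complex.exp _), ← Complex.exp_add, ← Complex.exp_add,
    ← Complex.exp_add, mul_assoc 2 (Complex.exp _), ← Complex.exp_add, mul_assoc]
  congr 3
  push_cast
  ring

/-- The product `Γ(n + 1/2 + iσ/2) Γ(n + 1/2 - iσ/2)` in elementary terms. -/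
theorem Gamma_add_half_mul_Gamma_add_half (n : ℕ) (σ : ℝ) :
    Complex.Gamma ((2 * n + 1 + Complex.I * σ) / 2)
        * Complex.Gamma ((2 * n + 1 - Complex.I * σ) / 2)
      = Real.pi * (Complex.cosh (Real.pi * σ / 2))⁻¹
        * ∏ m ∈ Finset.range n, (((σ : ℂ) ^ 2 + (2 * m + 1) ^ 2) / 4) := by
  induction n with
  | zero =>
    have h := Complex.Gamma_mul_Gamma_one_sub ((1 + Complex.I * σ) / 2)
    have h1 : (1 - (1 + Complex.I * σ) / 2) = (1 - Complex.I * σ) / 2 := by ring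
    have h2 : Real.pi * ((1 + Complex.I * σ) / 2)
        = (Real.pi * σ / 2) * Complex.I + Real.pi / 2 := by ring
    rw [h1, h2, Complex.sin_add_pi_div_two, Complex.cos_mul_I] at h
    simpa [div_eq_mul_inv] using h
  | succ n ih =>
    have hne (τ : ℝ) : (2 * n + 1 + Complex.I * τ) / 2 ≠ 0 := by
      intro h
      have := congrArg Complex.re h
      simp at this
      norm_cast at this
    have hne' := hne (-σ)
    push_cast at hne'
    rw [mul_neg, ← sub_eq_add_neg] at hne'
    have h1 : (2 * ((n + 1 : ℕ) : ℂ) + 1 + Complex.I * σ) / 2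
        = (2 * n + 1 + Complex.I * σ) / 2 + 1 := by push_cast; ring
    have h2 : (2 * ((n + 1 : ℕ) : ℂ) + 1 - Complex.I * σ) / 2
        = (2 * n + 1 - Complex.I * σ) / 2 + 1 := by push_cast; ring
    rw [h1, h2, Complex.Gamma_add_one _ (hne σ), Complex.Gamma_add_one _ hne',
      Finset.prod_range_succ, mul_mul_mul_comm, ih]
    ring_nf
    rw [Complex.I_sq]
    ring

/-- Fourier transform of an odd power of the hyperbolic secant: for every `n ≥ 0` and real `σ`,
`∫_ℝ (cosh r)^{−(2n+1)} e^{iσr} dr = (π/(2n)!)·sech(πσ/2)·∏_{m=0}^{n−1}(σ² + (2m+1)²)`. -/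
theorem sech_odd_fourier (n : ℕ) (σ : ℝ) :
    ∫ r : ℝ, (((Real.cosh r ^ (2 * n + 1))⁻¹ : ℝ) : ℂ) * Complex.exp (Complex.I * σ * r)
      = (((Real.pi / Nat.factorial (2 * n)) * (Real.cosh (Real.pi * σ / 2))⁻¹
          * ∏ m ∈ Finset.range n, (σ ^ 2 + ((2 * m + 1 : ℕ) : ℝ) ^ 2) : ℝ) : ℂ) := by
  have hre (τ : ℝ) : 0 < ((2 * n + 1 + Complex.I * τ) / 2).re := by
    simp
    positivity
  have hre' := hre (-σ)
  push_cast at hre'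
  rw [mul_neg, ← sub_eq_add_neg] at hre'
  have hsum : (2 * n + 1 + Complex.I * σ) / 2 + (2 * n + 1 - Complex.I * σ) / 2
      = ((2 * n : ℕ) : ℂ) + 1 := by push_cast; ring
  rw [integral_inv_cosh_pow_mul_cexp]
  push_cast
  rw [Complex.betaIntegral_eq_Gamma_mul_div _ _ (hre σ) hre', hsum,
    Complex.Gamma_nat_eq_factorial, Gamma_add_half_mul_Gamma_add_half, Finset.prod_div_distrib,
    Finset.prod_const, Finset.card_range, pow_mul]
  norm_num
  field_simp
end

section
/- For every integer n ≥ 1 and every real σ ≠ 0, ∫_ℝ (cosh r)^{−2n} · e^{i σ r} dr = (π · σ / (2n−1)!) · (1 / sinh(π σ / 2)) · ∏_{m=1}^{n−1} ( σ² + (2m)² ). -/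
open MeasureTheory Finset

lemma Real.sigmoid_two_mul_mul_one_sub (r : ℝ) :
    Real.sigmoid (2 * r) * (1 - Real.sigmoid (2 * r)) = (4 * Real.cosh r ^ 2)⁻¹ := by
  have h : Real.exp (-(2 * r)) = Real.exp (-r) ^ 2 := by rw [← Real.exp_nat_mul]; congr 1; simp
  have h1 : Real.exp r * Real.exp (-r) = 1 := by rw [← Real.exp_add]; simp
  have hp := Real.exp_pos (-r)
  have hr : Real.exp r = (Real.exp (-r))⁻¹ := by rw [Real.exp_neg, inv_inv]
  rw [Real.sigmoid_def, Real.cosh_eq, h, hr]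
  field_simp
  ring

/-- The beta integrand at `n ± a`, pulled back along `r ↦ sigmoid (2 * r)`. -/
lemma Complex.sigmoid_cpow_mul_one_sub_cpow (n : ℕ) (hn : 1 ≤ n) (a : ℂ) (r : ℝ) :
    (Real.sigmoid (2 * r) : ℂ) ^ ((n : ℂ) + a - 1)
        * (1 - (Real.sigmoid (2 * r) : ℂ)) ^ ((n : ℂ) - a - 1)
      = (((4 * Real.cosh r ^ 2)⁻¹ ^ (n - 1) : ℝ) : ℂ) * Complex.exp (2 * a * r) := by
  have hx := Real.sigmoid_pos (2 * r)
  obtain ⟨k, rfl⟩ : ∃ k, n = k + 1 := ⟨n - 1, by omega⟩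
  have hx0 : (Real.sigmoid (2 * r) : ℂ) ≠ 0 := by exact_mod_cast hx.ne'
  have he := Real.exp_pos (-(2 * r))
  have e1 : ((k + 1 : ℕ) : ℂ) + a - 1 = a + k := by push_cast; ring
  have e2 : ((k + 1 : ℕ) : ℂ) - a - 1 = -a + k := by push_cast; ring
  have h1 : (1 - (Real.sigmoid (2 * r) : ℂ))
      = (Real.exp (-(2 * r)) : ℂ) * (Real.sigmoid (2 * r) : ℂ) := by
    have h := Real.sigmoid_mul_rexp_neg (2 * r)
    rw [Real.sigmoid_neg, mul_comm] at h
    exact_mod_cast h.symm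
  have h10 : (1 - (Real.sigmoid (2 * r) : ℂ)) ≠ 0 := by
    rw [h1]; exact mul_ne_zero (by exact_mod_cast he.ne') hx0
  have h3 : (Real.exp (-(2 * r)) : ℂ) ^ (-a) = Complex.exp (2 * a * r) := by
    rw [Complex.cpow_def_of_ne_zero (by exact_mod_cast he.ne'), ← Complex.ofReal_log he.le,
      Real.log_exp]
    congr 1; push_cast; ring
  have h4 : (1 - (Real.sigmoid (2 * r) : ℂ)) ^ (-a)
      = Complex.exp (2 * a * r) * (Real.sigmoid (2 * r) : ℂ) ^ (-a) := by
    rw [h1, Complex.mul_cpow_ofReal_nonneg he.le hx.le, h3]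
  have h5 : (Real.sigmoid (2 * r) : ℂ) ^ a * (Real.sigmoid (2 * r) : ℂ) ^ (-a) = 1 := by
    rw [← Complex.cpow_add _ _ hx0]; simp
  rw [e1, e2, Complex.cpow_add _ _ hx0, Complex.cpow_add _ _ h10, Complex.cpow_natCast,
    Complex.cpow_natCast, h4, ← Real.sigmoid_two_mul_mul_one_sub]
  push_cast
  rw [mul_pow]
  linear_combination (Complex.exp (2 * a * r) * (Real.sigmoid (2 * r) : ℂ) ^ k
    * (1 - (Real.sigmoid (2 * r) : ℂ)) ^ k) * h5

lemma Real.hasDerivAt_sigmoid_two_mul (r : ℝ) :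
    HasDerivAt (fun r : ℝ ↦ Real.sigmoid (2 * r)) (2 * (4 * Real.cosh r ^ 2)⁻¹) r := by
  rw [← Real.sigmoid_two_mul_mul_one_sub, mul_comm]
  exact (Real.hasDerivAt_sigmoid (2 * r)).comp r ((hasDerivAt_id r).const_mul 2 |>.congr_deriv
    (mul_one 2))

/-- The beta integral at `n ± a` as an integral of a power of the hyperbolic secant. -/
lemma Complex.betaIntegral_eq_integral_cosh (n : ℕ) (hn : 1 ≤ n) (a : ℂ) :
    Complex.betaIntegral (n + a) (n - a)
      = 2 * (4 ^ n)⁻¹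
        * ∫ r : ℝ, (((Real.cosh r ^ (2 * n))⁻¹ : ℝ) : ℂ) * Complex.exp (2 * a * r) := by
  have himg : (fun r : ℝ ↦ Real.sigmoid (2 * r)) '' Set.univ = Set.Ioo 0 1 := by
    rw [Set.image_univ, ← Real.range_sigmoid]
    exact (mul_left_surjective₀ (two_ne_zero (α := ℝ))).range_comp Real.sigmoid
  have hinj : Set.InjOn (fun r : ℝ ↦ Real.sigmoid (2 * r)) Set.univ := fun x _ y _ h ↦ by
    simpa using Real.sigmoid_injective h
  rw [Complex.betaIntegral, intervalIntegral.integral_of_le zero_le_one,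
    integral_Ioc_eq_integral_Ioo, ← himg,
    integral_image_eq_integral_abs_deriv_smul MeasurableSet.univ
      (fun r _ ↦ (Real.hasDerivAt_sigmoid_two_mul r).hasDerivWithinAt) hinj,
    Measure.restrict_univ, ← integral_const_mul]
  refine integral_congr_ae (.of_forall fun r ↦ ?_)
  have hc := Real.cosh_pos r
  obtain ⟨k, rfl⟩ : ∃ k, n = k + 1 := ⟨n - 1, by omega⟩
  have hc' : (Real.cosh r : ℂ) ≠ 0 := by exact_mod_cast hc.ne'
  simp only [Complex.sigmoid_cpow_mul_one_sub_cpow _ hn]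
  rw [abs_of_pos (by positivity), Complex.real_smul, Nat.add_sub_cancel]
  push_cast [-Complex.ofReal_cosh]
  rw [inv_pow, mul_pow, ← pow_mul, mul_add 2 k 1, pow_add, pow_succ]
  field_simp
  ring

lemma Complex.Gamma_add_mul_Gamma_sub (k : ℕ) (a : ℂ) (ha : ∀ m : ℤ, a ≠ m) :
    Complex.Gamma ((k + 1 : ℕ) + a) * Complex.Gamma ((k + 1 : ℕ) - a)
      = Real.pi * a / Complex.sin (Real.pi * a)
        * ∏ m ∈ Finset.Icc 1 k, ((m : ℂ) ^ 2 - a ^ 2) := by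
  induction k with
  | zero =>
    have h := Complex.Gamma_mul_Gamma_one_sub a
    have h0 : a ≠ 0 := by simpa using ha 0
    simp only [zero_add, Nat.cast_one, Finset.Icc_eq_empty_of_lt one_pos, Finset.prod_empty,
      mul_one]
    rw [add_comm 1 a, Complex.Gamma_add_one a h0, mul_assoc, h]
    ring
  | succ k ih =>
    have h1 : ((k + 1 : ℕ) : ℂ) + a ≠ 0 := fun h ↦ ha (-(k + 1 : ℕ)) <| by
      push_cast at h ⊢; linear_combination h
    have h2 : ((k + 1 : ℕ) : ℂ) - a ≠ 0 := fun h ↦ ha (k + 1 : ℕ) <| by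
      push_cast at h ⊢; linear_combination -h
    rw [Finset.prod_Icc_succ_top (by omega), ← mul_assoc, ← ih,
      show ((k + 1 + 1 : ℕ) : ℂ) + a = ((k + 1 : ℕ) + a) + 1 by push_cast; ring,
      show ((k + 1 + 1 : ℕ) : ℂ) - a = ((k + 1 : ℕ) - a) + 1 by push_cast; ring,
      Complex.Gamma_add_one _ h1, Complex.Gamma_add_one _ h2]
    ring



/-- Fourier transform of an even power of the hyperbolic secant: for every `n ≥ 1` and real
`σ ≠ 0`, `∫_ℝ (cosh r)^{−2n} e^{iσr} dr = (πσ/(2n−1)!)·csch(πσ/2)·∏_{m=1}^{n−1}(σ² + (2m)²)`. -/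
theorem sech_even_fourier (n : ℕ) (hn : 1 ≤ n) (σ : ℝ) (hσ : σ ≠ 0) :
    ∫ r : ℝ, (((Real.cosh r ^ (2 * n))⁻¹ : ℝ) : ℂ) * Complex.exp (Complex.I * σ * r)
      = (((Real.pi * σ / Nat.factorial (2 * n - 1)) * (Real.sinh (Real.pi * σ / 2))⁻¹
          * ∏ m ∈ Finset.Icc 1 (n - 1), (σ ^ 2 + ((2 * m : ℕ) : ℝ) ^ 2) : ℝ) : ℂ) := by
  obtain ⟨k, rfl⟩ : ∃ k, n = k + 1 := ⟨n - 1, by omega⟩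
  have ha : ∀ m : ℤ, (σ / 2 * Complex.I : ℂ) ≠ m := fun m h ↦ hσ <| by
    simpa using congrArg Complex.im h
  have hB := Complex.Gamma_mul_Gamma_eq_betaIntegral
    (s := (k + 1 : ℕ) + σ / 2 * Complex.I) (t := (k + 1 : ℕ) - σ / 2 * Complex.I)
    (by simp; positivity) (by simp; positivity)
  rw [Complex.betaIntegral_eq_integral_cosh _ hn, Complex.Gamma_add_mul_Gamma_sub _ _ ha,
    show ((k + 1 : ℕ) + σ / 2 * Complex.I + ((k + 1 : ℕ) - σ / 2 * Complex.I) : ℂ)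
      = (2 * (k + 1) - 1 : ℕ) + 1 by
        rw [show 2 * (k + 1) - 1 = 2 * k + 1 by omega]; push_cast; ring,
    Complex.Gamma_nat_eq_factorial,
    show (Real.pi * (σ / 2 * Complex.I) : ℂ) = (Real.pi * σ / 2 : ℂ) * Complex.I by ring,
    Complex.sin_mul_I,
    show (2 * (σ / 2 * Complex.I) : ℂ) = Complex.I * σ by ring] at hB
  have hsinh : (Real.sinh (Real.pi * σ / 2) : ℂ) ≠ 0 := by
    rw [Complex.ofReal_ne_zero, Ne, Real.sinh_eq_zero]
    have := Real.pi_ne_zero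
    positivity
  have hprod : ∏ m ∈ Finset.Icc 1 k, ((m : ℂ) ^ 2 - (σ / 2 * Complex.I) ^ 2)
      = (4 ^ k)⁻¹ * ∏ m ∈ Finset.Icc 1 k, ((σ : ℂ) ^ 2 + (2 * m) ^ 2) := by
    have h4 : ((4 : ℂ) ^ k)⁻¹ = ∏ _m ∈ Finset.Icc 1 k, (4 : ℂ)⁻¹ := by simp
    rw [h4, ← Finset.prod_mul_distrib]
    refine Finset.prod_congr rfl fun m _ ↦ ?_
    rw [mul_pow, Complex.I_sq]
    ring
  have hf : ((2 * (k + 1) - 1).factorial : ℂ) ≠ 0 := by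
    exact_mod_cast Nat.factorial_ne_zero _
  rw [hprod] at hB
  push_cast at hB hsinh ⊢
  rw [pow_succ (4 : ℂ)] at hB
  generalize (∫ r : ℝ, _ : ℂ) = J at hB ⊢
  generalize ∏ m ∈ Finset.Icc 1 k, ((σ : ℂ) ^ 2 + (2 * m) ^ 2) = P at hB ⊢
  have h4 : (4 : ℂ) ^ k ≠ 0 := by simp
  have hI := Complex.I_ne_zero
  field_simp at hB ⊢
  linear_combination -hB / 4
end

section
/- For every integer n ≥ 1 and every real a > n − 1, ∫_0^∞ (cosh r)^{−a} · (sinh r)^{n−1} dr = Γ(n/2) · Γ((a + 1 − n)/2) / ( 2 · Γ((a + 1)/2) ). -/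
open MeasureTheory

/-- The Beta integral over the reals. -/
theorem integral_Ioo_rpow_mul_one_sub_rpow {u v : ℝ} (hu : 0 < u) (hv : 0 < v) :
    ∫ x in Set.Ioo (0 : ℝ) 1, x ^ (u - 1) * (1 - x) ^ (v - 1)
      = Real.Gamma u * Real.Gamma v / Real.Gamma (u + v) := by
  have key : ((∫ x in Set.Ioo (0 : ℝ) 1, x ^ (u - 1) * (1 - x) ^ (v - 1) : ℝ) : ℂ)
      = Complex.betaIntegral u v := by
    rw [Complex.betaIntegral, intervalIntegral.integral_of_le zero_le_one,
      integral_Ioc_eq_integral_Ioo, ← integral_complex_ofReal]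
    refine setIntegral_congr_fun measurableSet_Ioo fun x hx => ?_
    have hx₁ : 0 ≤ 1 - x := sub_nonneg.mpr hx.2.le
    simp [Complex.ofReal_cpow hx.1.le, Complex.ofReal_cpow hx₁]
  rw [Complex.betaIntegral_eq_Gamma_mul_div _ _ (by simpa) (by simpa), ← Complex.ofReal_add,
    Complex.Gamma_ofReal, Complex.Gamma_ofReal, Complex.Gamma_ofReal] at key
  exact_mod_cast key

theorem Real.hasDerivAt_tanh_sq (r : ℝ) :
    HasDerivAt (fun x => Real.tanh x ^ 2) (2 * Real.tanh r * (Real.cosh r ^ 2)⁻¹) r := by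
  have hc := (Real.cosh_pos r).ne'
  have h := (((Real.hasDerivAt_sinh r).div (Real.hasDerivAt_cosh r) hc).pow 2)
  have he : (fun x => Real.tanh x ^ 2) = (Real.sinh / Real.cosh) ^ 2 := by
    ext x
    simp [Real.tanh_eq_sinh_div_cosh]
  rw [he]
  convert! h using 1
  have := Real.cosh_sq r
  rw [show Real.cosh r * Real.cosh r - Real.sinh r * Real.sinh r = 1 by linarith]
  simp [Real.tanh_eq_sinh_div_cosh]

theorem Real.tanh_pos {r : ℝ} (hr : 0 < r) : 0 < Real.tanh r := by
  rw [Real.tanh_eq_sinh_div_cosh]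
  exact div_pos (Real.sinh_pos_iff.mpr hr) (Real.cosh_pos r)

theorem Real.injOn_tanh_sq : Set.InjOn (fun x => Real.tanh x ^ 2) (Set.Ioi 0) := by
  intro x hx y hy h
  exact Real.tanh_injective
    ((pow_left_inj₀ (Real.tanh_pos hx).le (Real.tanh_pos hy).le two_ne_zero).mp h)

theorem Real.image_tanh_sq_Ioi :
    (fun x => Real.tanh x ^ 2) '' Set.Ioi 0 = Set.Ioo 0 1 := by
  ext y
  constructor
  · rintro ⟨x, hx, rfl⟩
    exact ⟨pow_pos (Real.tanh_pos hx) 2, Real.tanh_sq_lt_one x⟩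
  · rintro ⟨h0, h1⟩
    have hs0 : 0 < √y := Real.sqrt_pos.mpr h0
    have hs1 : √y < 1 := by rwa [Real.sqrt_lt' one_pos, one_pow]
    refine ⟨Real.artanh √y, Real.artanh_pos ⟨hs0, hs1⟩, ?_⟩
    simp only
    rw [Real.tanh_artanh ⟨by linarith, hs1⟩, Real.sq_sqrt h0.le]

/-- The Beta integrand under the substitution `x = tanh² r`. -/
theorem Real.deriv_tanh_sq_mul_beta_integrand {r : ℝ} (hr : 0 < r) (p a : ℝ) :
    2 * Real.tanh r * (Real.cosh r ^ 2)⁻¹ * ((Real.tanh r ^ 2) ^ (p / 2 - 1) *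
        (1 - Real.tanh r ^ 2) ^ ((a + 1 - p) / 2 - 1))
      = 2 * (Real.cosh r ^ (-a) * Real.sinh r ^ (p - 1)) := by
  have hc := Real.cosh_pos r
  have hs : 0 < Real.sinh r := Real.sinh_pos_iff.mpr hr
  have ht := Real.tanh_pos hr
  have h1 : 1 - Real.tanh r ^ 2 = Real.cosh r ^ (-2 : ℝ) := by
    rw [Real.rpow_neg hc.le, Real.rpow_two, Real.tanh_eq_sinh_div_cosh]
    field_simp
    linarith [Real.cosh_sq r]
  have h2 : (Real.cosh r ^ 2)⁻¹ = Real.cosh r ^ (-2 : ℝ) := by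
    rw [Real.rpow_neg hc.le, Real.rpow_two]
  have h3 : Real.tanh r * (Real.tanh r ^ 2) ^ (p / 2 - 1)
      = Real.sinh r ^ (p - 1) * Real.cosh r ^ (-(p - 1)) := by
    rw [← Real.rpow_two, ← Real.rpow_mul ht.le]
    nth_rewrite 1 [← Real.rpow_one (Real.tanh r)]
    rw [← Real.rpow_add ht, Real.tanh_eq_sinh_div_cosh, Real.div_rpow hs.le hc.le,
      Real.rpow_neg hc.le, ← div_eq_mul_inv]
    ring_nf
  have h4 : Real.cosh r ^ (-a) = Real.cosh r ^ (-(p - 1)) * (Real.cosh r ^ (-2 : ℝ) *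
      (Real.cosh r ^ (-2 : ℝ)) ^ ((a + 1 - p) / 2 - 1)) := by
    rw [← Real.rpow_mul hc.le, ← Real.rpow_add hc, ← Real.rpow_add hc]
    ring_nf
  rw [h1, h2, h4]
  linear_combination 2 * Real.cosh r ^ (-2 : ℝ) *
    (Real.cosh r ^ (-2 : ℝ)) ^ ((a + 1 - p) / 2 - 1) * h3

/-- Normalization of the Herschel–Maxwell density on `n`-dimensional hyperbolic space:
for `n ≥ 1` and real `a > n − 1`,
`∫_0^∞ (cosh r)^{−a} (sinh r)^{n−1} dr = Γ(n/2)·Γ((a+1−n)/2) / (2·Γ((a+1)/2))`. -/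
theorem herschel_maxwell_normalization (n : ℕ) (hn : 1 ≤ n) (a : ℝ) (ha : (n : ℝ) - 1 < a) :
    ∫ r in Set.Ioi (0 : ℝ), Real.cosh r ^ (-a) * Real.sinh r ^ (n - 1)
      = Real.Gamma ((n : ℝ) / 2) * Real.Gamma ((a + 1 - n) / 2)
        / (2 * Real.Gamma ((a + 1) / 2)) := by
  have hn' : (0 : ℝ) < n := by exact_mod_cast hn
  have hbeta := integral_Ioo_rpow_mul_one_sub_rpow (u := (n : ℝ) / 2) (v := (a + 1 - n) / 2)
    (by linarith) (by linarith)
  rw [← Real.image_tanh_sq_Ioi, integral_image_eq_integral_abs_deriv_smul measurableSet_Ioi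
    (fun r _ => (Real.hasDerivAt_tanh_sq r).hasDerivWithinAt) Real.injOn_tanh_sq,
    show (n : ℝ) / 2 + (a + 1 - n) / 2 = (a + 1) / 2 by ring] at hbeta
  have hsubst : ∀ r ∈ Set.Ioi (0 : ℝ), |2 * Real.tanh r * (Real.cosh r ^ 2)⁻¹| •
      ((Real.tanh r ^ 2) ^ ((n : ℝ) / 2 - 1) * (1 - Real.tanh r ^ 2) ^ ((a + 1 - n) / 2 - 1))
      = 2 * (Real.cosh r ^ (-a) * Real.sinh r ^ (n - 1)) := by
    intro r hr
    have ht := Real.tanh_pos hr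
    rw [abs_of_nonneg (by positivity), smul_eq_mul, Real.deriv_tanh_sq_mul_beta_integrand hr,
      ← Real.rpow_natCast, Nat.cast_sub hn, Nat.cast_one]
  rw [setIntegral_congr_fun measurableSet_Ioi hsubst, integral_const_mul] at hbeta
  rw [mul_comm 2, ← div_div, ← hbeta, mul_div_cancel_left₀ _ two_ne_zero]
end

section
/- Let h : [0, ∞) → (0, ∞) be a continuous function satisfying h(u) · h(v) = h(0) · h( arcosh( cosh u · cosh v ) ) for all u, v ≥ 0. Then there exists a real number a such that h(r) = h(0) · (cosh r)^{−a} for all r ≥ 0. -/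
/-- The inverse hyperbolic cosine on `[1, ∞)`. -/
noncomputable def arcosh (x : ℝ) : ℝ := Real.log (x + Real.sqrt (x ^ 2 - 1))

theorem arcosh_eq_real_arcosh (x : ℝ) : arcosh x = Real.arcosh x := rfl

/-- Cauchy's functional equation on the half-line: a continuous additive function on `[0, ∞)`
is linear. -/
theorem eq_mul_of_continuousOn_of_additiveOn_Ici {g : ℝ → ℝ} (hg : ContinuousOn g (Set.Ici 0))
    (hadd : ∀ x y : ℝ, 0 ≤ x → 0 ≤ y → g (x + y) = g x + g y) {t : ℝ} (ht : 0 ≤ t) :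
    g t = t * g 1 := by
  have hzero : g 0 = 0 := by simpa using hadd 0 0 le_rfl le_rfl
  let F : ℝ →+ ℝ := AddMonoidHom.mk' (fun x => g (max x 0) - g (max (-x) 0)) (by
    intro x y
    have hsplit (z : ℝ) : max z 0 = z + max (-z) 0 := by
      rcases le_total z 0 with h | h <;> simp [h]
    have key : g (max (x + y) 0 + (max (-x) 0 + max (-y) 0))
        = g (max (-(x + y)) 0 + (max x 0 + max y 0)) := by
      congr 1
      rw [hsplit (x + y), hsplit x, hsplit y]
      ring
    have hn (z : ℝ) : 0 ≤ max z 0 := le_max_right _ _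
    rw [hadd _ _ (hn _) (add_nonneg (hn _) (hn _)), hadd _ _ (hn _) (hn _),
      hadd _ _ (hn _) (add_nonneg (hn _) (hn _)), hadd _ _ (hn _) (hn _)] at key
    linarith)
  have hF : Continuous F :=
    (hg.comp_continuous (f := fun x => max x 0) (by fun_prop) fun x => le_max_right x 0).sub
      (hg.comp_continuous (f := fun x => max (-x) 0) (by fun_prop) fun x => le_max_right (-x) 0)
  have hFg {x : ℝ} (hx : 0 ≤ x) : F x = g x := by
    change g (max x 0) - g (max (-x) 0) = g x
    rw [max_eq_left hx, max_eq_right (neg_nonpos.mpr hx), hzero, sub_zero]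
  have hlin := map_real_smul F hF t 1
  rwa [smul_eq_mul, smul_eq_mul, mul_one, hFg ht, hFg zero_le_one] at hlin

/-- The Herschel–Maxwell functional equation on the hyperbolic plane: if `h : [0,∞) → (0,∞)`
is continuous and satisfies `h(u)·h(v) = h(0)·h(arcosh(cosh u · cosh v))` for all `u, v ≥ 0`
(hyperbolic Pythagorean theorem), then `h(r) = h(0)·(cosh r)^{−a}` for some real `a`. -/
theorem herschel_maxwell_functional_equation (h : ℝ → ℝ)
    (hc : ContinuousOn h (Set.Ici 0)) (hpos : ∀ r : ℝ, 0 ≤ r → 0 < h r)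
    (heq : ∀ u v : ℝ, 0 ≤ u → 0 ≤ v →
      h u * h v = h 0 * h (arcosh (Real.cosh u * Real.cosh v))) :
    ∃ a : ℝ, ∀ r : ℝ, 0 ≤ r → h r = h 0 * Real.cosh r ^ (-a) := by
  simp only [arcosh_eq_real_arcosh] at heq
  let g : ℝ → ℝ := fun t => Real.log (h (Real.arcosh (Real.exp t))) - Real.log (h 0)
  have harc {t : ℝ} (ht : 0 ≤ t) : 0 ≤ Real.arcosh (Real.exp t) :=
    Real.arcosh_nonneg (Real.one_le_exp ht)
  have hg : ContinuousOn g (Set.Ici 0) := by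
    refine ContinuousOn.sub (ContinuousOn.log (hc.comp (Real.continuousOn_arcosh.comp
      Real.continuous_exp.continuousOn fun t ht => Real.one_le_exp ht) fun t ht => harc ht)
      fun t ht => (hpos _ (harc ht)).ne') continuousOn_const
  have hadd (x y : ℝ) (hx : 0 ≤ x) (hy : 0 ≤ y) : g (x + y) = g x + g y := by
    have hmul := heq _ _ (harc hx) (harc hy)
    rw [Real.cosh_arcosh (Real.one_le_exp hx), Real.cosh_arcosh (Real.one_le_exp hy),
      ← Real.exp_add] at hmul
    have hlog := congrArg Real.log hmul
    rw [Real.log_mul (hpos _ (harc hx)).ne' (hpos _ (harc hy)).ne',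
      Real.log_mul (hpos 0 le_rfl).ne' (hpos _ (harc (add_nonneg hx hy))).ne'] at hlog
    simp only [g]
    linarith
  refine ⟨-g 1, fun r hr => ?_⟩
  have hlin := eq_mul_of_continuousOn_of_additiveOn_Ici hg hadd
    (Real.log_nonneg (Real.one_le_cosh r))
  have hlog : g (Real.log (Real.cosh r)) = Real.log (h r) - Real.log (h 0) := by
    simp only [g]
    rw [Real.exp_log (Real.cosh_pos r), Real.arcosh_cosh hr]
  rw [neg_neg, Real.rpow_def_of_pos (Real.cosh_pos r), ← hlin, hlog, Real.exp_sub,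
    Real.exp_log (hpos r hr), Real.exp_log (hpos 0 le_rfl),
    mul_div_cancel₀ _ (hpos 0 le_rfl).ne']
end

section
/- Let 𝔤 be a finite-dimensional real Lie algebra with Killing form B, and let θ : 𝔤 → 𝔤 be a Lie algebra automorphism with θ ∘ θ = id. Let 𝔭 = {x ∈ 𝔤 : θ(x) = −x}, and let 𝔞 ⊆ 𝔭 be an abelian subspace that is maximal abelian in 𝔭, i.e. every x ∈ 𝔭 with [a, x] = 0 for all a ∈ 𝔞 belongs to 𝔞. Assume the restriction of B to 𝔞 × 𝔞 is nondegenerate. Let λ : 𝔞 → ℝ be linear, let ξ ∈ 𝔤 satisfy [a, ξ] = λ(a)·ξ for all a ∈ 𝔞, and let a_λ ∈ 𝔞 satisfy λ(a) = B(a_λ, a) for all a ∈ 𝔞. Then [ξ, θ(ξ)] = B(ξ, θ(ξ)) · a_λ. -/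
/-- Key bracket identity for constructing an `𝔰𝔩(2,ℝ)`-triple from a restricted root.
Let `𝔤` be a finite-dimensional real Lie algebra with Killing form `B`, `θ` an involutive
automorphism, `𝔭` its `(−1)`-eigenspace, `𝔞 ⊆ 𝔭` maximal abelian with `B` nondegenerate on
`𝔞`. If `[a, ξ] = λ(a)·ξ` for all `a ∈ 𝔞` and `λ(a) = B(a_λ, a)` with `a_λ ∈ 𝔞`, then
`[ξ, θ(ξ)] = B(ξ, θ(ξ)) · a_λ`. -/
theorem root_bracket_identity {L : Type*} [LieRing L] [LieAlgebra ℝ L]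
    [FiniteDimensional ℝ L]
    (θ : L →ₗ⁅ℝ⁆ L) (hθ : ∀ x : L, θ (θ x) = x)
    (a : Submodule ℝ L)
    (ha_p : ∀ x ∈ a, θ x = -x)
    (ha_ab : ∀ x ∈ a, ∀ y ∈ a, ⁅x, y⁆ = 0)
    (ha_max : ∀ x : L, θ x = -x → (∀ y ∈ a, ⁅y, x⁆ = 0) → x ∈ a)
    (hB_nondeg : ∀ x ∈ a, (∀ y ∈ a, killingForm ℝ L x y = 0) → x = 0)
    (lam : L → ℝ) (ξ : L)
    (hξ : ∀ x ∈ a, ⁅x, ξ⁆ = lam x • ξ)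
    (aLam : L) (haLam : aLam ∈ a)
    (hlam : ∀ x ∈ a, lam x = killingForm ℝ L aLam x) :
    ⁅ξ, θ ξ⁆ = killingForm ℝ L ξ (θ ξ) • aLam := by
  have hθξ : ∀ y ∈ a, ⁅y, θ ξ⁆ = -(lam y • θ ξ) := fun y hy => by
    have h := congrArg θ (hξ y hy)
    rw [LieHom.map_lie, ha_p y hy, neg_lie, map_smul] at h
    rw [← h, neg_neg]
  have hmem : ⁅ξ, θ ξ⁆ ∈ a := by
    refine ha_max _ ?_ fun y hy => ?_
    · rw [LieHom.map_lie, hθ, lie_skew]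
    · rw [leibniz_lie, hξ y hy, hθξ y hy, smul_lie, lie_neg, lie_smul, add_neg_cancel]
  refine sub_eq_zero.mp (hB_nondeg _ (a.sub_mem hmem (a.smul_mem _ haLam)) fun y hy => ?_)
  have h : killingForm ℝ L ⁅ξ, θ ξ⁆ y = lam y * killingForm ℝ L ξ (θ ξ) := by
    rw [LieModule.traceForm_comm, ← LieModule.traceForm_apply_lie_apply, hξ y hy, map_smul,
      LinearMap.smul_apply, smul_eq_mul]
  rw [map_sub, LinearMap.sub_apply, map_smul, LinearMap.smul_apply, h, hlam y hy, smul_eq_mul,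
    mul_comm, sub_self]
end
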